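/- arXiv:2402.09370 — 3 statements merged into one kernel-verified Lean document; each statement's English description precedes it below -/
import Mathlib

section
/- Let n ≥ 1 and let p ≥ 2 be an even integer. If X_1, …, X_n are independent uniformly random variables taking values in {−1, 1}, then E[(X_1 + ⋯ + X_n)^p] ≤ n^{p/2} · (p−1)!!, where (p−1)!! = (p−1)·(p−3)⋯3·1. Equivalently, the number of tuples (i_1, …, i_p) ∈ {1,…,n}^p in which every value occurs an even number of times is at most n^{p/2}·(p−1)!!. -/
open Finset
open scoped Classical

noncomputable def DD (k : ℕ) : ℝ := ((2 * k).factorial : ℝ) / (2 ^ k * (k.factorial : ℝ))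

noncomputable def SS (n p : ℕ) : ℝ :=
  ∑ x : Fin n → Bool, (∑ i, (if x i then (1 : ℝ) else -1)) ^ p

lemma DD_eq (k : ℕ) : DD k = (Nat.doubleFactorial (2 * k - 1) : ℝ) := by
  unfold DD
  rcases k with _ | k
  · simp
  · have h1 := Nat.factorial_eq_mul_doubleFactorial (2 * k + 1)
    have h2 := Nat.doubleFactorial_two_mul (k + 1)
    have e1 : 2 * (k + 1) = 2 * k + 1 + 1 := by ring
    have e2 : 2 * (k + 1) - 1 = 2 * k + 1 := by omega
    rw [e1] at h2
    rw [e2, e1, h1, h2]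
    have : ((k+1).factorial : ℝ) ≠ 0 := by positivity
    push_cast
    field_simp

lemma DD_ineq (i j : ℕ) :
    ((2 * (i + j)).choose (2 * j) : ℝ) * DD j ≤ ((i + j).choose j : ℝ) * DD (i + j) := by
  have h : ((2 ^ i * i.factorial : ℕ) : ℝ) ≤ ((2 * i).factorial : ℝ) := by
    exact_mod_cast Nat.two_pow_mul_factorial_le_factorial_two_mul i
  push_cast at h
  have hc1 : ((2 * (i + j)).choose (2 * j) : ℝ)
      = ((2 * (i + j)).factorial : ℝ) / ((2 * j).factorial * (2 * i).factorial) := by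
    rw [Nat.cast_choose ℝ (by omega)]
    congr 4; omega
  have hc2 : ((i + j).choose j : ℝ)
      = ((i + j).factorial : ℝ) / (j.factorial * i.factorial) := by
    rw [Nat.cast_choose ℝ (by omega)]
    congr 4; omega
  rw [hc1, hc2]
  unfold DD
  have a1 : (0 : ℝ) < (2 * (i + j)).factorial := by positivity
  have a2 : (0 : ℝ) < (2 * j).factorial := by positivity
  have a3 : (0 : ℝ) < (2 * i).factorial := by positivity
  have a4 : (0 : ℝ) < (i + j).factorial := by positivity
  have a5 : (0 : ℝ) < j.factorial := by positivity
  have a6 : (0 : ℝ) < i.factorial := by positivity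
  calc _ = ((2 * (i + j)).factorial : ℝ) / (2 ^ j * j.factorial) / (2 * i).factorial := by
        field_simp
    _ ≤ ((2 * (i + j)).factorial : ℝ) / (2 ^ j * j.factorial) / (2 ^ i * i.factorial) := by
        gcongr
    _ = _ := by
        rw [pow_add]; field_simp

lemma sum_split (f : ℕ → ℝ) (k : ℕ) :
    ∑ m ∈ range (2 * k + 1), f m
      = ∑ j ∈ range (k + 1), f (2 * j) + ∑ j ∈ range k, f (2 * j + 1) := by
  induction k with
  | zero => simp
  | succ k ih =>
    rw [show 2 * (k + 1) + 1 = (2 * k + 1) + 1 + 1 by ring, sum_range_succ, sum_range_succ, ih,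
      sum_range_succ _ (k + 1), sum_range_succ (fun j => f (2 * j + 1)) k]
    rw [show 2 * (k + 1) = 2 * k + 1 + 1 by ring]
    ring

lemma even_part (s : ℝ) (k : ℕ) :
    (1 + s) ^ (2 * k) + (-1 + s) ^ (2 * k)
      = 2 * ∑ j ∈ range (k + 1), ((2 * k).choose (2 * j) : ℝ) * s ^ (2 * j) := by
  have h : (-1 + s) ^ (2 * k) = (-s + 1) ^ (2 * k) := by
    rw [pow_mul, pow_mul]; ring
  rw [h, add_comm 1 s, add_pow, add_pow, sum_split, sum_split]
  have o : ∀ j, (-s) ^ (2 * j + 1) = - s ^ (2 * j + 1) := fun j => Odd.neg_pow ⟨j, rfl⟩ s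
  have e : ∀ j, (-s) ^ (2 * j) = s ^ (2 * j) := fun j => Even.neg_pow (even_two_mul j) s
  simp only [o, e, one_pow, mul_one, neg_mul, sum_neg_distrib]
  rw [mul_sum]
  have : ∀ a b : ℝ, a + b + (a + -b) = 2 * a := by intros; ring
  rw [this, mul_sum]
  refine sum_congr rfl fun j _ => by ring

lemma SS_succ (n k : ℕ) :
    SS (n + 1) (2 * k)
      = 2 * ∑ j ∈ range (k + 1), ((2 * k).choose (2 * j) : ℝ) * SS n (2 * j) := by
  unfold SS
  rw [← (Fin.consEquiv (fun _ => Bool)).sum_comp, Fintype.sum_prod_type]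
  simp only [Fin.consEquiv_apply, Fin.sum_univ_succ, Fin.cons_zero, Fin.cons_succ,
    Fintype.sum_bool]
  simp only [if_true, Bool.false_eq_true, if_false]
  rw [← sum_add_distrib]
  simp only [even_part, mul_sum]
  rw [sum_comm]

lemma SS_le (n k : ℕ) : SS n (2 * k) ≤ 2 ^ n * ((n : ℝ) ^ k * DD k) := by
  induction n generalizing k with
  | zero =>
    rcases k with _ | k
    · simp [SS, DD]
    · simp [SS]
  | succ n ih =>
    rw [SS_succ]
    calc _ ≤ 2 * ∑ j ∈ range (k + 1),
            2 ^ n * ((n : ℝ) ^ j * ((k.choose j : ℝ) * DD k)) := by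
          refine mul_le_mul_of_nonneg_left (sum_le_sum fun j hj => ?_) (by norm_num)
          have hj' : j ≤ k := by simpa [Nat.lt_succ_iff] using hj
          obtain ⟨i, rfl⟩ := Nat.exists_eq_add_of_le' hj'
          calc _ ≤ ((2 * (i + j)).choose (2 * j) : ℝ) * (2 ^ n * ((n : ℝ) ^ j * DD j)) := by
                gcongr
                exact ih j
            _ = 2 ^ n * ((n : ℝ) ^ j * (((2 * (i + j)).choose (2 * j) : ℝ) * DD j)) := by ring
            _ ≤ _ := by
                gcongr 2 ^ n * ((n : ℝ) ^ j * ?_)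
                exact DD_ineq i j
      _ = _ := by
          push_cast
          rw [add_pow, pow_succ, sum_mul, mul_sum, mul_sum]
          refine sum_congr rfl fun j _ => by simp; ring

/-- Let `n ≥ 1` and let `p ≥ 2` be even.  If `X₁, …, X_n` are independent
uniform `{−1, 1}`-valued random variables, then `E[(X₁ + ⋯ + X_n)^p] ≤ n^{p/2}·(p−1)‼`. -/
theorem stmt_10 (n p : ℕ) (hn : 1 ≤ n) (hp : 2 ≤ p) (hpe : Even p) :
    (1 / 2 ^ n : ℝ) * ∑ x : Fin n → Bool, (∑ i, (if x i then (1 : ℝ) else -1)) ^ p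
      ≤ (n : ℝ) ^ (p / 2) * (Nat.doubleFactorial (p - 1) : ℝ) := by
  obtain ⟨k, rfl⟩ := hpe.two_dvd
  rw [Nat.mul_div_cancel_left k (by norm_num), ← DD_eq]
  have h := SS_le n k
  unfold SS at h
  rw [one_div, inv_mul_le_iff₀ (by positivity)]
  exact h
end

section
/- Let n ≥ 1, let S be a linear subspace of F_2^n, and let 0 ≤ k ≤ n. Let W be uniformly distributed over the set of all k-dimensional linear subspaces of F_2^n. For any integer d such that the event dim(W ∩ S) = d has positive probability, the conditional distribution of W ∩ S given dim(W ∩ S) = d is uniform over the set of all d-dimensional linear subspaces of S. -/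
theorem aux_extend {K M : Type*} [Field K] [AddCommGroup M] [Module K M] [FiniteDimensional K M]
    (A B : Submodule K M) (f : A ≃ₗ[K] B) : ∃ e : M ≃ₗ[K] M, ∀ x : A, e x = f x := by
  obtain ⟨C, hC⟩ := A.exists_isCompl
  obtain ⟨D, hD⟩ := B.exists_isCompl
  have h1 := Submodule.finrank_add_eq_of_isCompl hC
  have h2 := Submodule.finrank_add_eq_of_isCompl hD
  have h3 := f.finrank_eq
  have g : C ≃ₗ[K] D := LinearEquiv.ofFinrankEq C D (by omega)
  refine ⟨(Submodule.prodEquivOfIsCompl A C hC).symm.trans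
    ((f.prodCongr g).trans (Submodule.prodEquivOfIsCompl B D hD)), fun x => ?_⟩
  simp

theorem aux_equiv {K M : Type*} [Field K] [AddCommGroup M] [Module K M] [FiniteDimensional K M]
    (S A B : Submodule K M) (hA : A ≤ S) (hB : B ≤ S)
    (h : Module.finrank K A = Module.finrank K B) :
    ∃ e : M ≃ₗ[K] M, S.map e.toLinearMap = S ∧ A.map e.toLinearMap = B := by
  let f : A.submoduleOf S ≃ₗ[K] B.submoduleOf S :=
    (Submodule.submoduleOfEquivOfLe hA).trans ((LinearEquiv.ofFinrankEq A B h).trans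
      (Submodule.submoduleOfEquivOfLe hB).symm)
  obtain ⟨e₁, h₁⟩ := aux_extend _ _ f
  obtain ⟨e, he⟩ := aux_extend S S e₁
  refine ⟨e, ?_, ?_⟩
  · apply Submodule.eq_of_le_of_finrank_eq
    · rintro _ ⟨x, hx, rfl⟩
      have := he ⟨x, hx⟩
      simp only [LinearEquiv.coe_coe] at this ⊢
      rw [this]
      exact (e₁ _).2
    · exact LinearEquiv.finrank_map_eq e S
  · apply Submodule.eq_of_le_of_finrank_eq
    · rintro _ ⟨x, hx, rfl⟩
      have h2 := he ⟨x, hA hx⟩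
      have h3 := h₁ ⟨⟨x, hA hx⟩, hx⟩
      simp only [LinearEquiv.coe_coe] at h2 h3 ⊢
      rw [h2, h3]
      exact (f _).2
    · rw [← h]
      exact LinearEquiv.finrank_map_eq e A

theorem aux_fiber {K M : Type*} [Field K] [AddCommGroup M] [Module K M] [FiniteDimensional K M]
    (k : ℕ) (S A B : Submodule K M) (hA : A ≤ S) (hB : B ≤ S)
    (h : Module.finrank K A = Module.finrank K B) :
    Nonempty ({W : Submodule K M // Module.finrank K W = k ∧ W ⊓ S = A} ≃
      {W : Submodule K M // Module.finrank K W = k ∧ W ⊓ S = B}) := by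
  obtain ⟨e, hS, hAB⟩ := aux_equiv S A B hA hB h
  refine ⟨(Submodule.orderIsoMapComap e).toEquiv.subtypeEquiv fun W => ?_⟩
  have h1 : Module.finrank K (W.map e.toLinearMap) = Module.finrank K W :=
    LinearEquiv.finrank_map_eq e W
  have h2 : W.map e.toLinearMap ⊓ S = (W ⊓ S).map e.toLinearMap := by
    rw [Submodule.map_inf _ e.injective, hS]
  have h3 : W.map e.toLinearMap ⊓ S = B ↔ W ⊓ S = A := by
    rw [h2, ← hAB]
    exact (Submodule.map_injective_of_injective e.injective).eq_iff
  change _ ↔ Module.finrank K (W.map e.toLinearMap) = k ∧ W.map e.toLinearMap ⊓ S = B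
  rw [h1, h3]

/-- Let `S` be a linear subspace of `F₂ⁿ`, let `0 ≤ k ≤ n`, and let `W` be
uniform over the `k`-dimensional subspaces of `F₂ⁿ`.  For any `d` such that the event
`dim(W ⊓ S) = d` has positive probability, the conditional distribution of `W ⊓ S` given
`dim(W ⊓ S) = d` is uniform over the `d`-dimensional subspaces of `S`: for every
`d`-dimensional subspace `U ≤ S`,
`#{W : dim W = k ∧ W ⊓ S = U} · #{U' ≤ S : dim U' = d} = #{W : dim W = k ∧ dim(W ⊓ S) = d}`. -/
theorem stmt_12 (n k d : ℕ) (hk : k ≤ n)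
    (S : Submodule (ZMod 2) (Fin n → ZMod 2))
    (hpos : Nat.card {W : Submodule (ZMod 2) (Fin n → ZMod 2) //
        Module.finrank (ZMod 2) W = k ∧ Module.finrank (ZMod 2) ↥(W ⊓ S) = d} ≠ 0)
    (U : Submodule (ZMod 2) (Fin n → ZMod 2)) (hUS : U ≤ S)
    (hUd : Module.finrank (ZMod 2) U = d) :
    Nat.card {W : Submodule (ZMod 2) (Fin n → ZMod 2) //
        Module.finrank (ZMod 2) W = k ∧ W ⊓ S = U} *
      Nat.card {U' : Submodule (ZMod 2) (Fin n → ZMod 2) //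
        U' ≤ S ∧ Module.finrank (ZMod 2) U' = d} =
    Nat.card {W : Submodule (ZMod 2) (Fin n → ZMod 2) //
        Module.finrank (ZMod 2) W = k ∧ Module.finrank (ZMod 2) ↥(W ⊓ S) = d} := by
  classical
  have key : ∀ U' : {U' : Submodule (ZMod 2) (Fin n → ZMod 2) //
        U' ≤ S ∧ Module.finrank (ZMod 2) U' = d},
      Nonempty ({W : Submodule (ZMod 2) (Fin n → ZMod 2) //
        Module.finrank (ZMod 2) W = k ∧ W ⊓ S = U'.1} ≃
        {W : Submodule (ZMod 2) (Fin n → ZMod 2) //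
        Module.finrank (ZMod 2) W = k ∧ W ⊓ S = U}) := fun U' =>
    aux_fiber k S U'.1 U U'.2.1 hUS (U'.2.2.trans hUd.symm)
  rw [mul_comm, ← Nat.card_prod]
  symm
  apply Nat.card_congr
  refine Equiv.trans ?_ ((Equiv.sigmaCongrRight fun U' => (key U').some).trans
    (Equiv.sigmaEquivProd _ _))
  exact
    { toFun := fun W => ⟨⟨W.1 ⊓ S, inf_le_right, W.2.2⟩, ⟨W.1, W.2.1, rfl⟩⟩
      invFun := fun p => ⟨p.2.1, p.2.2.1, by rw [p.2.2.2]; exact p.1.2.2⟩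
      left_inv := fun W => rfl
      right_inv := by
        rintro ⟨⟨U', hU'⟩, ⟨W, hW, hWU⟩⟩
        change W ⊓ S = U' at hWU
        subst hWU
        rfl }
end

section
/- For all constants C > 0 and δ ∈ (0,1], there exist a constant c > 0 and N₀ such that the following holds for all N ≥ N₀, all integers 0 ≤ N' ≤ C·N, and all reals Δ with |Δ| ≤ C·√N. Let X_1, …, X_N and Y_1, …, Y_{N'} be independent uniformly random {−1,1}-valued variables, and let Z_1, …, Z_N be independent {−1,1}-valued variables, independent of the X's and Y's, each with expectation δ. Then Pr[ sgn(Σ_{j=1}^N X_j·Z_j) = sgn(Σ_{j=1}^N X_j + Σ_{j=1}^{N'} Y_j + Δ) ] ≥ 1/2 + c, where sgn(0) is resolved by an independent fair coin taking values in {−1, 1}. -/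
open Finset
open scoped Classical

/-- The sign of `v` as an element of `{-1, 1}`, with `sgn 0` resolved by the coin. -/
noncomputable def sgnc (v : ℝ) (coin : Bool) : ℝ :=
  if 0 < v then 1 else if v < 0 then -1 else (if coin then 1 else -1)

/-- A boolean as a `{-1, 1}`-valued real. -/
def pmOf (b : Bool) : ℝ := if b then 1 else -1

/-- expectation over independent biased bits, `P(V j = true) = (1 + q j)/2` -/
noncomputable def Ex {n : ℕ} (q : Fin n → ℝ) (F : (Fin n → Bool) → ℝ) : ℝ :=
  ∑ V : Fin n → Bool, (∏ j, (if V j then (1 + q j) / 2 else (1 - q j) / 2)) * F V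

lemma Ex_succ {n : ℕ} (q : Fin (n+1) → ℝ) (F : (Fin (n+1) → Bool) → ℝ) :
    Ex q F = (1 + q 0) / 2 * Ex (fun j => q j.succ) (fun V => F (Fin.cons true V))
      + (1 - q 0) / 2 * Ex (fun j => q j.succ) (fun V => F (Fin.cons false V)) := by
  unfold Ex
  rw [← (Fin.consEquiv (fun _ => Bool)).sum_comp, Fintype.sum_prod_type, Fintype.sum_bool]
  simp only [Fin.consEquiv_apply, Fin.prod_univ_succ, Fin.cons_zero, Fin.cons_succ, mul_sum,
    mul_assoc]
  simp [Fin.consEquiv]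

lemma Ex_const {n : ℕ} (q : Fin n → ℝ) (c : ℝ) : Ex q (fun _ => c) = c := by
  induction n with
  | zero => simp [Ex]
  | succ n ih => rw [Ex_succ, ih]; ring

lemma weight_nonneg {n : ℕ} (q : Fin n → ℝ) (hq : ∀ j, |q j| ≤ 1) (V : Fin n → Bool) :
    0 ≤ ∏ j, (if V j then (1 + q j) / 2 else (1 - q j) / 2) := by
  apply Finset.prod_nonneg
  intro j _
  have := abs_le.1 (hq j)
  split_ifs <;> linarith [this.1, this.2]

lemma Ex_le {n : ℕ} (q : Fin n → ℝ) (hq : ∀ j, |q j| ≤ 1) (F G : (Fin n → Bool) → ℝ)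
    (h : ∀ V, F V ≤ G V) : Ex q F ≤ Ex q G :=
  Finset.sum_le_sum fun V _ => mul_le_mul_of_nonneg_left (h V) (weight_nonneg q hq V)

lemma Ex_add {n : ℕ} (q : Fin n → ℝ) (F G : (Fin n → Bool) → ℝ) :
    Ex q (fun V => F V + G V) = Ex q F + Ex q G := by
  simp [Ex, mul_add, Finset.sum_add_distrib]

lemma Ex_mul {n : ℕ} (q : Fin n → ℝ) (c : ℝ) (F : (Fin n → Bool) → ℝ) :
    Ex q (fun V => c * F V) = c * Ex q F := by
  simp only [Ex, Finset.mul_sum]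
  exact Finset.sum_congr rfl fun V _ => by ring

lemma Ex_affine {n : ℕ} (q : Fin n → ℝ) (a b : ℝ) (F : (Fin n → Bool) → ℝ) :
    Ex q (fun V => a + b * F V) = a + b * Ex q F := by
  rw [Ex_add, Ex_const, Ex_mul]

lemma Ex_mono {n : ℕ} (q r : Fin n → ℝ) (hq : ∀ j, |q j| ≤ 1) (hr : ∀ j, |r j| ≤ 1)
    (h : ∀ j, q j ≤ r j) (F : (Fin n → Bool) → ℝ) (hF : Monotone F) : Ex q F ≤ Ex r F := by
  induction n with
  | zero => simp [Ex]
  | succ n ih =>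
    rw [Ex_succ, Ex_succ]
    have hm : ∀ b : Bool, Monotone (fun V : Fin n → Bool => F (Fin.cons b V)) := by
      intro b V W hVW
      apply hF
      intro j
      refine Fin.cases ?_ (fun i => ?_) j
      · simp
      · simpa using hVW i
    have h1 := ih (fun j => q j.succ) (fun j => r j.succ) (fun j => hq _) (fun j => hr _)
      (fun j => h _) _ (hm true)
    have h2 := ih (fun j => q j.succ) (fun j => r j.succ) (fun j => hq _) (fun j => hr _)
      (fun j => h _) _ (hm false)
    have h3 : Ex (fun j => q j.succ) (fun V => F (Fin.cons false V)) ≤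
        Ex (fun j => q j.succ) (fun V => F (Fin.cons true V)) := by
      apply Ex_le _ (fun j => hq _)
      intro V
      apply hF
      intro j
      refine Fin.cases ?_ (fun i => ?_) j <;> simp
    have a := abs_le.1 (hq 0)
    have b := abs_le.1 (hr 0)
    have c := h 0
    nlinarith [mul_nonneg (by linarith [b.1] : 0 ≤ 1 + r 0) (sub_nonneg.2 h1),
      mul_nonneg (by linarith [b.2] : 0 ≤ 1 - r 0) (sub_nonneg.2 h2),
      mul_nonneg (sub_nonneg.2 c) (sub_nonneg.2 h3)]

lemma Ex_sq {n : ℕ} (δ : ℝ) (a : Fin n → ℝ) (ha : ∀ j, a j ^ 2 = 1) (x : ℝ) :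
    Ex (fun _ => δ) (fun V => (∑ j, a j * (pmOf (V j) - δ) + x) ^ 2) = x ^ 2 + n * (1 - δ ^ 2) := by
  induction n generalizing x with
  | zero => simp [Ex]
  | succ n ih =>
    rw [Ex_succ]
    have e : ∀ b : Bool, (fun V : Fin n → Bool =>
        (∑ j, a j * (pmOf ((Fin.cons b V : Fin (n+1) → Bool) j) - δ) + x) ^ 2) =
        (fun V => (∑ j, a (Fin.succ j) * (pmOf (V j) - δ) + (a 0 * (pmOf b - δ) + x)) ^ 2) := by
      intro b
      funext V
      rw [Fin.sum_univ_succ]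
      simp only [Fin.cons_zero, Fin.cons_succ]
      ring
    rw [e, e, ih _ (fun j => ha _), ih _ (fun j => ha _)]
    have := ha 0
    simp only [pmOf, if_true, Bool.false_eq_true, if_false]
    push_cast
    linear_combination (1 - δ ^ 2) * this

lemma Ex_exp {n : ℕ} (μ : ℝ) :
    Ex (fun _ : Fin n => 0) (fun V => Real.exp (μ * ∑ j, pmOf (V j))) = Real.cosh μ ^ n := by
  induction n with
  | zero => simp [Ex]
  | succ n ih =>
    rw [Ex_succ]
    have e : ∀ b : Bool, (fun V : Fin n → Bool =>
        Real.exp (μ * ∑ j, pmOf ((Fin.cons b V : Fin (n+1) → Bool) j))) =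
        (fun V => Real.exp (μ * pmOf b) * Real.exp (μ * ∑ j, pmOf (V j))) := by
      intro b
      funext V
      rw [Fin.sum_univ_succ, ← Real.exp_add]
      simp only [Fin.cons_zero, Fin.cons_succ]
      ring_nf
    rw [e, e, Ex_mul, Ex_mul, ih]
    simp only [pmOf, if_true, Bool.false_eq_true, if_false]
    rw [pow_succ, Real.cosh_eq]
    ring_nf

lemma exp_le_aux (y : ℝ) (h0 : 0 ≤ y) (h1 : y ≤ 1/2) : Real.exp y ≤ 1 + 2 * y := by
  have h := Real.add_one_le_exp (-y)
  have h2 : Real.exp y * Real.exp (-y) = 1 := by rw [← Real.exp_add]; simp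
  have h3 := Real.exp_pos y
  have h4 : Real.exp y * (1 - y) ≤ 1 := by nlinarith
  have h5 : 1 ≤ (1 + 2 * y) * (1 - y) := by nlinarith
  exact le_of_mul_le_mul_right (h4.trans h5) (by linarith)

lemma cosh_ge_aux (μ : ℝ) : 1 + μ ^ 2 / 2 ≤ Real.cosh μ := by
  have h := Real.cosh_sq' (μ / 2)
  have h2 := Real.cosh_two_mul (μ / 2)
  rw [show 2 * (μ / 2) = μ by ring] at h2
  have h3 : (μ / 2) ^ 2 ≤ Real.sinh (μ / 2) ^ 2 := by
    apply sq_le_sq.2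
    rcases le_total 0 (μ / 2) with h | h
    · rw [abs_of_nonneg h, abs_of_nonneg (Real.sinh_nonneg_iff.2 h)]
      exact Real.self_le_sinh_iff.2 h
    · rw [abs_of_nonpos h, abs_of_nonpos (Real.sinh_nonpos_iff.2 h)]
      linarith [Real.sinh_le_self_iff.2 h]
  nlinarith

/-- lower tail: `P(S ≥ K √N)` is bounded below. -/
lemma tail (K : ℝ) (hK : 0 < K) : ∃ p : ℝ, 0 < p ∧ ∃ N₀ : ℕ, 1 ≤ N₀ ∧ ∀ N ≥ N₀,
    p ≤ Ex (fun _ : Fin N => 0) (fun V => if K * Real.sqrt N ≤ ∑ j, pmOf (V j) then 1 else 0) := by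
  set l : ℝ := 4 * K + 8 with hl
  set A : ℝ := Real.exp (l * K) with hA
  have hA0 : 0 < A := Real.exp_pos _
  have hE0 : 0 < Real.exp (2 * l ^ 2) := Real.exp_pos _
  refine ⟨A ^ 2 / Real.exp (2 * l ^ 2), by positivity, ⌈l ^ 2⌉₊ + 1, by omega, ?_⟩
  intro N hN
  have hN1 : l ^ 2 ≤ N := by
    have := Nat.le_ceil (l ^ 2)
    have h2 : ((⌈l ^ 2⌉₊ : ℕ) : ℝ) ≤ N := by exact_mod_cast (by omega : ⌈l ^ 2⌉₊ ≤ N)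
    linarith
  have hNpos : (0 : ℝ) < N := by exact_mod_cast (by omega : 0 < N)
  have hs : 0 < Real.sqrt N := Real.sqrt_pos.2 hNpos
  have hss : Real.sqrt N ^ 2 = N := Real.sq_sqrt hNpos.le
  set μ : ℝ := l / Real.sqrt N with hμ
  have hμ2 : μ ^ 2 * N = l ^ 2 := by rw [hμ, div_pow, hss]; field_simp
  have hμ1 : μ ^ 2 ≤ 1 := by
    rw [hμ, div_pow, hss]; exact (div_le_one hNpos).2 hN1
  have h1 : 2 * A ≤ Ex (fun _ : Fin N => 0) (fun V => Real.exp (μ * ∑ j, pmOf (V j))) := by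
    rw [Ex_exp]
    have a1 : Real.exp (μ ^ 2 / 4) ≤ Real.cosh μ := by
      have := exp_le_aux (μ ^ 2 / 4) (by positivity) (by linarith)
      linarith [cosh_ge_aux μ]
    have a2 := pow_le_pow_left₀ (Real.exp_pos _).le a1 N
    rw [← Real.exp_nat_mul] at a2
    refine le_trans ?_ a2
    rw [show (N : ℝ) * (μ ^ 2 / 4) = l * K + 2 * l by
      rw [show (N : ℝ) * (μ ^ 2 / 4) = μ ^ 2 * N / 4 by ring, hμ2, hl]; ring, Real.exp_add]
    have := Real.add_one_le_exp (2 * l)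
    nlinarith
  have h2 : Ex (fun _ : Fin N => 0) (fun V => Real.exp ((2 * μ) * ∑ j, pmOf (V j)))
      ≤ Real.exp (2 * l ^ 2) := by
    rw [Ex_exp]
    have a2 := pow_le_pow_left₀ (Real.cosh_pos _).le (Real.cosh_le_exp_half_sq (2 * μ)) N
    refine a2.trans ?_
    rw [← Real.exp_nat_mul, ← hμ2]
    apply le_of_eq
    congr 1
    ring
  set η : ℝ := A / Real.exp (2 * l ^ 2) / 2 with hη
  have hη0 : 0 < η := by positivity
  set I : (Fin N → Bool) → ℝ :=
    fun V => if K * Real.sqrt N ≤ ∑ j, pmOf (V j) then 1 else 0 with hI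
  have h3 : Ex (fun _ : Fin N => 0) (fun V => Real.exp (μ * ∑ j, pmOf (V j))) ≤
      Ex (fun _ : Fin N => 0) (fun V => (A + η * Real.exp ((2 * μ) * ∑ j, pmOf (V j)))
        + (1 / (4 * η)) * I V) := by
    apply Ex_le _ (by simp)
    intro V
    have e : Real.exp ((2 * μ) * ∑ j, pmOf (V j)) = Real.exp (μ * ∑ j, pmOf (V j)) ^ 2 := by
      rw [← Real.exp_nat_mul]; congr 1; push_cast; ring
    simp only [e, hI]
    split_ifs with h
    · set U := Real.exp (μ * ∑ j, pmOf (V j))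
      have : 0 ≤ η * (U - 1 / (2 * η)) ^ 2 := by positivity
      have e2 : η * (U - 1 / (2 * η)) ^ 2 = η * U ^ 2 - U + 1 / (4 * η) * 1 := by
        field_simp
        ring
      linarith
    · have : Real.exp (μ * ∑ j, pmOf (V j)) ≤ A := by
        apply Real.exp_le_exp.2
        have hl0 : 0 < l := by positivity
        rw [hμ, div_mul_eq_mul_div, div_le_iff₀ hs]
        push Not at h
        nlinarith
      have : 0 ≤ η * Real.exp (μ * ∑ j, pmOf (V j)) ^ 2 := by positivity
      linarith
  rw [Ex_add, Ex_add, Ex_const, Ex_mul, Ex_mul] at h3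
  have h4 : η * Ex (fun _ : Fin N => 0) (fun V => Real.exp ((2 * μ) * ∑ j, pmOf (V j))) ≤ A / 2 := by
    refine (mul_le_mul_of_nonneg_left h2 hη0.le).trans (le_of_eq ?_)
    rw [hη]; field_simp
  have h5 : A / 2 ≤ 1 / (4 * η) * Ex (fun _ : Fin N => 0) I := by linarith
  rw [one_div_mul_eq_div, le_div_iff₀ (by positivity)] at h5
  refine le_trans (le_of_eq ?_) h5
  rw [hη]; field_simp; ring

/-- conditional expectation of the sign given `X` -/
noncomputable def hX {n : ℕ} (δ : ℝ) (X : Fin n → Bool) : ℝ :=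
  Ex (fun _ => δ) (fun Z => Real.sign (∑ j, pmOf (X j) * pmOf (Z j)))

lemma pm_not (b : Bool) : pmOf (!b) = - pmOf b := by cases b <;> simp [pmOf]

lemma pm_sq (b : Bool) : pmOf b ^ 2 = 1 := by cases b <;> simp [pmOf]

lemma hX_neg {n : ℕ} (δ : ℝ) (X : Fin n → Bool) : hX δ (fun j => !X j) = - hX δ X := by
  have : (fun Z : Fin n → Bool => Real.sign (∑ j, pmOf (!X j) * pmOf (Z j))) =
      fun Z => (-1) * Real.sign (∑ j, pmOf (X j) * pmOf (Z j)) := by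
    funext Z
    simp only [pm_not, neg_mul, Finset.sum_neg_distrib, Real.sign_neg, one_mul]
  unfold hX
  rw [this, Ex_mul]; ring

lemma hX_perm {n : ℕ} (δ : ℝ) (X : Fin n → Bool) (σ : Equiv.Perm (Fin n)) :
    hX δ (fun j => X (σ j)) = hX δ X := by
  unfold hX Ex
  rw [← Equiv.sum_comp (Equiv.arrowCongr σ.symm (Equiv.refl Bool))]
  apply Finset.sum_congr rfl
  intro Z _
  beta_reduce
  rw [← Equiv.prod_comp σ (fun j => if Z j then (1 + δ) / 2 else (1 - δ) / 2), ← Equiv.sum_comp σ (fun j => pmOf (X j) * pmOf (Z j))]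
  simp [Equiv.arrowCongr]

lemma hX_eq {n : ℕ} (δ : ℝ) (X : Fin n → Bool) :
    hX δ X = Ex (fun j => δ * pmOf (X j)) (fun V => Real.sign (∑ j, pmOf (V j))) := by
  have hinv : Function.Involutive (fun (Z : Fin n → Bool) => fun j => X j == Z j) := by
    intro Z; funext j; cases h : X j <;> cases h' : Z j <;> simp [h, h']
  unfold hX Ex
  rw [← Equiv.sum_comp (hinv.toPerm _)]
  apply Finset.sum_congr rfl
  intro Z _
  congr 1
  · apply Finset.prod_congr rfl
    intro j _
    cases h : X j <;> cases h' : Z j <;> simp [h, h', pmOf, sub_eq_add_neg]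
  · beta_reduce
    congr 1
    apply Finset.sum_congr rfl
    intro j _
    cases h : X j <;> cases h' : Z j <;> simp [h, h', pmOf] 

lemma sign_mono {a b : ℝ} (h : a ≤ b) : Real.sign a ≤ Real.sign b := by
  rcases lt_trichotomy a 0 with ha | ha | ha <;> rcases lt_trichotomy b 0 with hb | hb | hb <;>
    simp [Real.sign_of_neg, Real.sign_of_pos, ha, hb] <;> linarith

lemma pm_mono {a b : Bool} (h : a ≤ b) : pmOf a ≤ pmOf b := by
  revert h; cases a <;> cases b <;> simp [pmOf]

lemma hX_mono {n : ℕ} (δ : ℝ) (h1 : 0 < δ) (h2 : δ ≤ 1) (X X' : Fin n → Bool) (h : X ≤ X') :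
    hX δ X ≤ hX δ X' := by
  have hb : ∀ b : Bool, |δ * pmOf b| ≤ 1 := by
    intro b; cases b <;> simp [pmOf, abs_of_pos h1, h2]
  rw [hX_eq, hX_eq]
  apply Ex_mono _ _ (fun j => hb _) (fun j => hb _)
  · intro j
    exact mul_le_mul_of_nonneg_left (pm_mono (h j)) h1.le
  · intro V W hVW
    exact sign_mono (Finset.sum_le_sum fun j _ => pm_mono (hVW j))

lemma exists_perm {n : ℕ} (X : Fin n → Bool) (h : 0 ≤ ∑ j, pmOf (X j)) :
    ∃ σ : Equiv.Perm (Fin n), ∀ j, X j = false → X (σ j) = true := by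
  have hc : (univ.filter fun j => X j = false).card ≤ (univ.filter fun j => X j = true).card := by
    have e : ∑ j, pmOf (X j) = ((univ.filter fun j => X j = true).card : ℝ)
        - (univ.filter fun j => X j = false).card := by
      rw [Finset.card_filter, Finset.card_filter]
      push_cast
      rw [← Finset.sum_sub_distrib]
      apply Finset.sum_congr rfl
      intro j _
      cases X j <;> simp [pmOf]
    rw [e] at h
    exact_mod_cast (sub_nonneg.1 h)
  obtain ⟨A, hA, hAc⟩ := Finset.exists_subset_card_eq hc
  have e : {j // j ∈ univ.filter fun j => X j = false} ≃ {j // j ∈ A} :=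
    Finset.equivOfCardEq hAc.symm
  refine ⟨e.extendSubtype, fun j hj => ?_⟩
  have := e.extendSubtype_mem j (by simpa using hj)
  simpa using hA this

lemma hX_nonneg {n : ℕ} (δ : ℝ) (h1 : 0 < δ) (h2 : δ ≤ 1) (X : Fin n → Bool)
    (h : 0 ≤ ∑ j, pmOf (X j)) : 0 ≤ hX δ X := by
  obtain ⟨σ, hσ⟩ := exists_perm X h
  have := hX_mono δ h1 h2 (fun j => !X j) (fun j => X (σ j)) (by
    intro j
    cases hj : X j
    · simp [hσ j hj]
    · simp [hj])
  rw [hX_neg, hX_perm] at this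
  linarith

lemma hX_big {n : ℕ} (δ : ℝ) (h1 : 0 < δ) (h2 : δ ≤ 1) (X : Fin n → Bool) (K : ℝ)
    (hK : 2 / δ ≤ K) (hn : 1 ≤ n)
    (h : K * Real.sqrt n ≤ ∑ j, pmOf (X j)) : 1 / 2 ≤ hX δ X := by
  set S := ∑ j, pmOf (X j) with hS
  have hnp : (0 : ℝ) < n := by exact_mod_cast hn
  have hs : 0 < Real.sqrt n := Real.sqrt_pos.2 hnp
  have hss : Real.sqrt n ^ 2 = n := Real.sq_sqrt hnp.le
  have hδK : 2 ≤ δ * K := by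
    rw [div_le_iff₀ h1] at hK; linarith
  have hm : 2 * Real.sqrt n ≤ δ * S := by nlinarith
  have hm0 : 0 < δ * S := by linarith
  have hm2 : 4 * n ≤ (δ * S) ^ 2 := by nlinarith
  have hsq := Ex_sq δ (fun j => pmOf (X j)) (fun j => pm_sq _) 0
  have key : Ex (fun _ => δ) (fun V : Fin n → Bool => 1 + (-2 / (δ * S) ^ 2) *
      (∑ j, pmOf (X j) * (pmOf (V j) - δ) + 0) ^ 2) ≤ hX δ X := by
    apply Ex_le _ (fun _ => abs_le.2 ⟨by linarith, h2⟩)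
    intro V
    have e : ∑ j, pmOf (X j) * (pmOf (V j) - δ) + 0 = ∑ j, pmOf (X j) * pmOf (V j) - δ * S := by
      simp only [mul_sub, Finset.sum_sub_distrib, ← Finset.sum_mul]; rw [hS]; ring
    rw [e]
    set T := ∑ j, pmOf (X j) * pmOf (V j)
    have hp : 0 < (δ * S) ^ 2 := by positivity
    rcases lt_or_ge 0 T with hT | hT
    · rw [Real.sign_of_pos hT]
      have : 0 ≤ 2 / (δ * S) ^ 2 * (T - δ * S) ^ 2 := by positivity
      have e : -2 / (δ * S) ^ 2 * (T - δ * S) ^ 2 = - (2 / (δ * S) ^ 2 * (T - δ * S) ^ 2) := by ring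
      linarith
    · have hsg : -1 ≤ Real.sign T := by
        rcases Real.sign_apply_eq T with h | h | h <;> rw [h] <;> norm_num
      have h3 : (δ * S) ^ 2 ≤ (T - δ * S) ^ 2 := by nlinarith
      have h4 : 2 ≤ 2 / (δ * S) ^ 2 * (T - δ * S) ^ 2 := by
        rw [div_mul_eq_mul_div, le_div_iff₀ hp]; linarith
      have e : -2 / (δ * S) ^ 2 * (T - δ * S) ^ 2 = - (2 / (δ * S) ^ 2 * (T - δ * S) ^ 2) := by ring
      linarith
  rw [Ex_add, Ex_const, Ex_mul, hsq] at key
  refine le_trans ?_ key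
  have hp : 0 < (δ * S) ^ 2 := by positivity
  have : 2 / (δ * S) ^ 2 * (n * (1 - δ ^ 2)) ≤ 1 / 2 := by
    rw [div_mul_eq_mul_div, div_le_iff₀ hp]
    nlinarith [mul_nonneg hnp.le (sq_nonneg δ)]
  have e : -2 / (δ * S) ^ 2 * (0 ^ 2 + n * (1 - δ ^ 2)) = - (2 / (δ * S) ^ 2 * (n * (1 - δ ^ 2))) := by
    ring
  linarith

lemma Ex_flip {n : ℕ} (F : (Fin n → Bool) → ℝ) :
    Ex (fun _ => 0) F = Ex (fun _ => 0) (fun X => F (fun j => !X j)) := by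
  have hinv : Function.Involutive (fun (Z : Fin n → Bool) => fun j => !Z j) := by
    intro Z; funext j; simp
  unfold Ex
  rw [← Equiv.sum_comp (hinv.toPerm _)]
  simp

/-- pointwise bound after symmetrization -/
lemma sym_term {n : ℕ} (δ : ℝ) (h1 : 0 < δ) (h2 : δ ≤ 1) (X : Fin n → Bool) (w : ℝ) :
    0 ≤ hX δ X * (Real.sign (∑ j, pmOf (X j) + w) + Real.sign (∑ j, pmOf (X j) - w)) := by
  set S := ∑ j, pmOf (X j) with hS
  rcases le_total 0 S with h | h
  · apply mul_nonneg (hX_nonneg δ h1 h2 X h)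
    have := sign_mono (by linarith : -(S - w) ≤ S + w)
    rw [Real.sign_neg] at this; linarith
  · apply mul_nonneg_of_nonpos_of_nonpos
    · have := hX_nonneg δ h1 h2 (fun j => !X j) (by
        simp only [pm_not, Finset.sum_neg_distrib]; rw [← hS]; linarith)
      rw [hX_neg] at this; linarith
    · have := sign_mono (by linarith : (S + w) ≤ -(S - w))
      rw [Real.sign_neg] at this; linarith

lemma corr_eq {n : ℕ} (δ w : ℝ) :
    Ex (fun _ : Fin n => 0) (fun X => hX δ X * Real.sign (∑ j, pmOf (X j) + w)) =
    Ex (fun _ : Fin n => 0) (fun X => (1/2) * (hX δ X *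
      (Real.sign (∑ j, pmOf (X j) + w) + Real.sign (∑ j, pmOf (X j) - w)))) := by
  have e := Ex_flip (fun X : Fin n → Bool => hX δ X * Real.sign (∑ j, pmOf (X j) + w))
  have e2 : (fun X : Fin n → Bool => hX δ (fun j => !X j) * Real.sign (∑ j, pmOf (!X j) + w)) =
      fun X => hX δ X * Real.sign (∑ j, pmOf (X j) - w) := by
    funext X
    rw [hX_neg]
    simp only [pm_not, Finset.sum_neg_distrib]
    rw [show -∑ j, pmOf (X j) + w = -(∑ j, pmOf (X j) - w) by ring, Real.sign_neg]
    ring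
  rw [e2] at e
  rw [Ex_mul]
  simp only [mul_add]
  rw [Ex_add, ← e]; ring

lemma coin_sum (a b : ℝ) (m : ℝ) : ∑ s₁ : Bool, ∑ s₂ : Bool, (m * (1/2) * (1/2)) *
    (if sgnc a s₁ = sgnc b s₂ then (1 : ℝ) else 0) =
    m * (1 / 2 + 1 / 2 * (Real.sign a * Real.sign b)) := by
  rcases lt_trichotomy a 0 with ha | ha | ha <;> rcases lt_trichotomy b 0 with hb | hb | hb <;>
    simp [sgnc, Real.sign_of_neg, Real.sign_of_pos, ha, hb, ha.le, hb.le, not_lt_of_ge] <;> norm_num <;> ring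

/-- For all constants `C > 0` and `δ ∈ (0,1]` there exist `c > 0` and `N₀`
such that for all `N ≥ N₀`, all `0 ≤ N' ≤ C·N` and all `|Δ| ≤ C·√N`: with `X₁, …, X_N` and
`Y₁, …, Y_{N'}` independent uniform `{−1,1}` variables and `Z₁, …, Z_N` independent
`{−1,1}` variables of expectation `δ` (so `P(Z_j = 1) = (1+δ)/2`), and with the two
`sgn(0)`'s resolved by independent fair coins `s₁, s₂`,
`Pr[sgn(Σ X_j Z_j) = sgn(Σ X_j + Σ Y_j + Δ)] ≥ 1/2 + c`. -/
theorem stmt_14 (C δ : ℝ) (hC : 0 < C) (hδ1 : 0 < δ) (hδ2 : δ ≤ 1) :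
    ∃ c : ℝ, 0 < c ∧ ∃ N₀ : ℕ, ∀ N ≥ N₀, ∀ N' : ℕ, (N' : ℝ) ≤ C * N →
      ∀ Δ : ℝ, |Δ| ≤ C * Real.sqrt N →
        1/2 + c ≤
          ∑ X : Fin N → Bool, ∑ Y : Fin N' → Bool, ∑ Z : Fin N → Bool,
            ∑ s₁ : Bool, ∑ s₂ : Bool,
              ((1 / 2 ^ N : ℝ) * (1 / 2 ^ N' : ℝ) *
                (∏ j, (if Z j then (1 + δ) / 2 else (1 - δ) / 2)) * (1/2) * (1/2)) *
              (if sgnc (∑ j, pmOf (X j) * pmOf (Z j)) s₁ =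
                  sgnc ((∑ j, pmOf (X j)) + (∑ j, pmOf (Y j)) + Δ) s₂
               then 1 else 0) := by
  set K : ℝ := 3 * C + 2 + 2 / δ with hK
  have hd : 0 < 2 / δ := by positivity
  obtain ⟨p, hp, N₀, hN₀, ht⟩ := tail K (by positivity)
  refine ⟨p / 8, by positivity, N₀, ?_⟩
  intro N hN N' hN' Δ hΔ
  have hN1 : 1 ≤ N := by omega
  have hnp : (0 : ℝ) < N := by exact_mod_cast hN1
  have hs : 0 < Real.sqrt N := Real.sqrt_pos.2 hnp
  have hss : Real.sqrt N ^ 2 = N := Real.sq_sqrt hnp.le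
  have tN := ht N hN
  have eq : ∀ (n : ℕ) (F : (Fin n → Bool) → ℝ), ∑ X, (1 / 2 ^ n : ℝ) * F X = Ex (fun _ => 0) F := by
    intro n F
    simp [Ex]
  have total : (∑ X : Fin N → Bool, ∑ Y : Fin N' → Bool, ∑ Z : Fin N → Bool,
            ∑ s₁ : Bool, ∑ s₂ : Bool,
              ((1 / 2 ^ N : ℝ) * (1 / 2 ^ N' : ℝ) *
                (∏ j, (if Z j then (1 + δ) / 2 else (1 - δ) / 2)) * (1/2) * (1/2)) *
              (if sgnc (∑ j, pmOf (X j) * pmOf (Z j)) s₁ =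
                  sgnc ((∑ j, pmOf (X j)) + (∑ j, pmOf (Y j)) + Δ) s₂
               then 1 else 0)) =
      Ex (fun _ : Fin N' => 0) (fun Y => 1 / 2 + 1 / 2 * Ex (fun _ : Fin N => 0)
        (fun X => hX δ X * Real.sign (∑ j, pmOf (X j) + (∑ j, pmOf (Y j) + Δ)))) := by
    simp only [coin_sum]
    rw [Finset.sum_comm, ← eq]
    apply Finset.sum_congr rfl
    intro Y _
    rw [← Ex_affine, ← eq, Finset.mul_sum]
    apply Finset.sum_congr rfl
    intro X _
    have : hX δ X * Real.sign (∑ j, pmOf (X j) + (∑ j, pmOf (Y j) + Δ)) =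
      Real.sign (∑ j, pmOf (X j) + (∑ j, pmOf (Y j) + Δ)) * hX δ X := mul_comm _ _
    rw [this]
    unfold hX
    rw [← Ex_mul, ← Ex_affine]
    unfold Ex
    simp only [Finset.mul_sum]
    apply Finset.sum_congr rfl
    intro Z _
    rw [add_assoc (∑ j, pmOf (X j))]
    ring
  rw [total]
  have inner : ∀ Y : Fin N' → Bool,
      p / 2 * (1 + (-1 / ((2 * C + 2) ^ 2 * N)) * (∑ j, 1 * (pmOf (Y j) - 0) + 0) ^ 2) ≤
      Ex (fun _ : Fin N => 0)
        (fun X => hX δ X * Real.sign (∑ j, pmOf (X j) + (∑ j, pmOf (Y j) + Δ))) := by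
    intro Y
    rw [corr_eq]
    simp only [one_mul, sub_zero, add_zero]
    set V := ∑ j, pmOf (Y j) with hV
    have hq : 0 < (2 * C + 2) ^ 2 * (N : ℝ) := by positivity
    have e : -1 / ((2 * C + 2) ^ 2 * (N : ℝ)) * V ^ 2 = - (V ^ 2 / ((2 * C + 2) ^ 2 * N)) := by ring
    rw [e]
    rcases lt_or_ge |V| ((2 * C + 2) * Real.sqrt N) with h | h
    · have hw : |V + Δ| < K * Real.sqrt N := by
        have := abs_add_le V Δ
        have : 0 < 2 / δ * Real.sqrt N := by positivity
        rw [hK]; nlinarith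
      have h5 : p / 2 ≤ Ex (fun _ : Fin N => 0) (fun X => (1/2) * (hX δ X *
          (Real.sign (∑ j, pmOf (X j) + (V + Δ)) + Real.sign (∑ j, pmOf (X j) - (V + Δ))))) := by
        have : p / 2 ≤ Ex (fun _ : Fin N => 0)
            (fun X => (1/2) * (if K * Real.sqrt N ≤ ∑ j, pmOf (X j) then 1 else 0)) := by
          rw [Ex_mul]; linarith
        refine this.trans (Ex_le _ (by simp) _ _ ?_)
        intro X
        apply mul_le_mul_of_nonneg_left _ (by norm_num)
        split_ifs with hS
        · have := hX_big δ hδ1 hδ2 X K (by rw [hK]; linarith) hN1 hS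
          have hw' := abs_lt.1 hw
          rw [Real.sign_of_pos (by linarith [hw'.1]), Real.sign_of_pos (by linarith [hw'.2])]
          linarith
        · exact sym_term δ hδ1 hδ2 X _
      have : 0 ≤ V ^ 2 / ((2 * C + 2) ^ 2 * N) := by positivity
      nlinarith
    · have h5 : 0 ≤ Ex (fun _ : Fin N => 0) (fun X => (1/2) * (hX δ X *
          (Real.sign (∑ j, pmOf (X j) + (V + Δ)) + Real.sign (∑ j, pmOf (X j) - (V + Δ))))) := by
        refine (Ex_const (fun _ : Fin N => (0:ℝ)) 0).symm.le.trans (Ex_le _ (by simp) _ _ ?_)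
        intro X
        exact mul_nonneg (by norm_num) (sym_term δ hδ1 hδ2 X _)
      have : 1 ≤ V ^ 2 / ((2 * C + 2) ^ 2 * N) := by
        rw [le_div_iff₀ hq, one_mul, ← sq_abs V, ← hss, ← mul_pow]
        exact pow_le_pow_left₀ (by positivity) h 2
      nlinarith
  have fin := Ex_le (fun _ : Fin N' => (0:ℝ)) (by simp) _ _ inner
  have hsq := Ex_sq 0 (fun _ : Fin N' => (1:ℝ)) (fun _ => one_pow 2) 0
  rw [Ex_mul, Ex_add, Ex_const, Ex_mul, hsq] at fin
  rw [Ex_add, Ex_const, Ex_mul]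
  have hb : -1 / ((2 * C + 2) ^ 2 * (N : ℝ)) * (0 ^ 2 + N' * (1 - 0 ^ 2)) ≥ - (1/2) := by
    have hq : 0 < (2 * C + 2) ^ 2 * (N : ℝ) := by positivity
    have e : -1 / ((2 * C + 2) ^ 2 * (N : ℝ)) * (0 ^ 2 + N' * (1 - 0 ^ 2)) =
      - (N' / ((2 * C + 2) ^ 2 * (N : ℝ))) := by ring
    rw [e]
    have : (N' : ℝ) / ((2 * C + 2) ^ 2 * (N : ℝ)) ≤ 1 / 2 := by
      rw [div_le_iff₀ hq]
      have : 2 * C ≤ (2 * C + 2) ^ 2 := by nlinarith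
      nlinarith
    linarith
  nlinarith
end
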